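/- Let X be a GC_5 set of 21 nodes with no maximal line, and let A0 ∈ X be a node with m-d sequence (5,5,5,3,2) realized by the ordered used lines (ℓ1,ℓ2,ℓ3,ℓ4,ℓ5); set 𝒜 := X ∩ (ℓ1 ∪ ℓ2 ∪ ℓ3) (#𝒜 = 15) and ℬ := X \ 𝒜 (#ℬ = 6). Let B ∈ ℬ. Then the number of lines through B that contain exactly three nodes of 𝒜 is at most 4. -/

import Mathlib

open MvPolynomial

/-- Evaluation of a bivariate polynomial at a point of the real plane. -/
noncomputable def ev (p : MvPolynomial (Fin 2) ℝ) (A : ℝ × ℝ) : ℝ :=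
  MvPolynomial.eval ![A.1, A.2] p

/-- A polynomial of total degree exactly 1, defining a line. -/
def IsLinePoly (l : MvPolynomial (Fin 2) ℝ) : Prop := l.totalDegree = 1

/-- The line (zero set) defined by a polynomial. -/
def lineSet (l : MvPolynomial (Fin 2) ℝ) : Set (ℝ × ℝ) := {A | ev l A = 0}

/-- The number of nodes of `X` lying on the line defined by `l`. -/
noncomputable def nodesOn (X : Set (ℝ × ℝ)) (l : MvPolynomial (Fin 2) ℝ) : ℕ :=
  (X ∩ lineSet l).ncard

/-- `X` is an `n`-poised set: it has `N = (n+2)(n+1)/2` nodes and the only polynomial of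
degree ≤ n vanishing on all of `X` is the zero polynomial. -/
def Poised (n : ℕ) (X : Set (ℝ × ℝ)) : Prop :=
  X.Finite ∧ X.ncard = (n + 2) * (n + 1) / 2 ∧
    ∀ p : MvPolynomial (Fin 2) ℝ, p.totalDegree ≤ n → (∀ A ∈ X, ev p A = 0) → p = 0

/-- `p` is an `n`-fundamental polynomial of the node `A` with respect to `X`. -/
def IsFund (n : ℕ) (X : Set (ℝ × ℝ)) (A : ℝ × ℝ) (p : MvPolynomial (Fin 2) ℝ) : Prop :=
  p.totalDegree ≤ n ∧ ev p A = 1 ∧ ∀ B ∈ X, B ≠ A → ev p B = 0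

/-- `X` is a `GC_n` set: it is `n`-poised and each fundamental polynomial is a product of
`n` linear (degree-1) polynomials. -/
def GCSet (n : ℕ) (X : Set (ℝ × ℝ)) : Prop :=
  Poised n X ∧ ∀ A ∈ X, ∃ p : MvPolynomial (Fin 2) ℝ, IsFund n X A p ∧
    ∃ f : Fin n → MvPolynomial (Fin 2) ℝ, (∀ i, IsLinePoly (f i)) ∧ p = ∏ i, f i

/-- The node `A` uses the line `l`: the linear polynomial `l` divides a fundamental
polynomial of `A`. -/
def Uses (n : ℕ) (X : Set (ℝ × ℝ)) (A : ℝ × ℝ) (l : MvPolynomial (Fin 2) ℝ) : Prop :=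
  ∃ p, IsFund n X A p ∧ l ∣ p

/-- `X` has no maximal line, i.e. no line passes through `n+1` nodes of `X`. -/
def NoMaximalLine (n : ℕ) (X : Set (ℝ × ℝ)) : Prop :=
  ∀ l : MvPolynomial (Fin 2) ℝ, IsLinePoly l → nodesOn X l ≠ n + 1

/-- Number of nodes of `X` on the line `l` which do not lie on any of the lines
`L 0, …, L (s-1)` (the primary node count of `l` at step `s`). -/
noncomputable def resCount (X : Set (ℝ × ℝ)) (L : Fin 5 → MvPolynomial (Fin 2) ℝ)
    (s : Fin 5) (l : MvPolynomial (Fin 2) ℝ) : ℕ :=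
  {B ∈ X | ev l B = 0 ∧ ∀ i : Fin 5, i < s → ev (L i) B ≠ 0}.ncard

/-- `L` is an m-line sequence of the node `A` of the `GC_5` set `X`: it enumerates the five
distinct used lines of `A` (a fundamental polynomial of `A` is, up to a constant, the
product of the `L i`), ordered greedily: at each step `s` the line `L s` has maximal
primary node count among the remaining used lines. -/
def MLineSeq (X : Set (ℝ × ℝ)) (A : ℝ × ℝ) (L : Fin 5 → MvPolynomial (Fin 2) ℝ) : Prop :=
  (∀ i, IsLinePoly (L i)) ∧
  (∀ i j : Fin 5, i ≠ j → lineSet (L i) ≠ lineSet (L j)) ∧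
  (∃ p : MvPolynomial (Fin 2) ℝ, IsFund 5 X A p ∧ ∃ c : ℝ, p = MvPolynomial.C c * ∏ i, L i) ∧
  (∀ s t : Fin 5, s ≤ t → resCount X L s (L t) ≤ resCount X L s (L s))

/-- The node `A` has m-distribution sequence `k`. -/
def HasMDSeq (X : Set (ℝ × ℝ)) (A : ℝ × ℝ) (k : Fin 5 → ℕ) : Prop :=
  ∃ L : Fin 5 → MvPolynomial (Fin 2) ℝ, MLineSeq X A L ∧ ∀ s, resCount X L s (L s) = k s

lemma ev_mul (p q : MvPolynomial (Fin 2) ℝ) (A : ℝ × ℝ) : ev (p * q) A = ev p A * ev q A := by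
  simp [ev]

lemma ev_sub (p q : MvPolynomial (Fin 2) ℝ) (A : ℝ × ℝ) : ev (p - q) A = ev p A - ev q A := by
  simp [ev]

lemma ev_prod {ι : Type*} (s : Finset ι) (f : ι → MvPolynomial (Fin 2) ℝ) (A : ℝ × ℝ) :
    ev (∏ i ∈ s, f i) A = ∏ i ∈ s, ev (f i) A := by
  simp [ev, map_prod]

lemma IsLinePoly.ne_zero {l : MvPolynomial (Fin 2) ℝ} (hl : IsLinePoly l) : l ≠ 0 := by
  rintro rfl
  simp [IsLinePoly] at hl

lemma IsLinePoly.prime {l : MvPolynomial (Fin 2) ℝ} (hl : IsLinePoly l) : Prime l := by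
  refine (irreducible_of_totalDegree_eq_one hl fun x hx => ?_).prime
  rw [isUnit_iff_ne_zero]
  rintro rfl
  exact hl.ne_zero (MvPolynomial.ext _ _ fun i => by simpa using hx i)

/-- A line polynomial is an affine function with non-zero linear part. -/
lemma IsLinePoly.exists_ev_eq {l : MvPolynomial (Fin 2) ℝ} (hl : IsLinePoly l) :
    ∃ a b c : ℝ, (a ≠ 0 ∨ b ≠ 0) ∧ ∀ A : ℝ × ℝ, ev l A = a * A.1 + b * A.2 + c := by
  set a := l.coeff (Finsupp.single 0 1)
  set b := l.coeff (Finsupp.single 1 1)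
  set c := l.coeff 0
  have key : l = C a * X 0 + C b * X 1 + C c := by
    refine MvPolynomial.ext _ _ fun m => ?_
    by_cases hm : m.degree ≤ 1
    · have hcases : m = 0 ∨ m = Finsupp.single 0 1 ∨ m = Finsupp.single 1 1 := by
        have hd : m 0 + m 1 ≤ 1 := by
          simpa [Finsupp.degree_eq_sum] using hm
        rcases Nat.eq_zero_or_pos (m 0) with h0 | h0
        · rcases Nat.eq_zero_or_pos (m 1) with h1 | h1
          · left; ext i; fin_cases i <;> simp [h0, h1]
          · right; right; ext i; fin_cases i
            · simp [h0]
            · simp; omega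
        · right; left; ext i; fin_cases i
          · simp; omega
          · simp; omega
      rcases hcases with rfl | rfl | rfl <;>
        simp [a, b, c, coeff_X, coeff_C, Finsupp.single_left_inj, eq_comm (a := (0 : Fin 2 →₀ ℕ))]
    · have hlt : l.totalDegree < m.degree := by rw [hl]; omega
      rw [coeff_eq_zero_of_totalDegree_lt hlt]
      have h0 : (Finsupp.single 0 1 : Fin 2 →₀ ℕ) ≠ m := by rintro rfl; simp at hm
      have h1 : (Finsupp.single 1 1 : Fin 2 →₀ ℕ) ≠ m := by rintro rfl; simp at hm
      have h2 : (0 : Fin 2 →₀ ℕ) ≠ m := by rintro rfl; simp at hm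
      simp [coeff_X, coeff_C, h0, h1, h2]
  refine ⟨a, b, c, ?_, fun A => by rw [key]; simp [ev]⟩
  by_contra! h
  rw [h.1, h.2] at key
  have hd : l.totalDegree = 1 := hl
  rw [key] at hd
  simp at hd

/-- A line through two distinct points is contained in every line through these points. -/
lemma lineSet_subset_of_mem {l m : MvPolynomial (Fin 2) ℝ} (hl : IsLinePoly l)
    (hm : IsLinePoly m) {P Q : ℝ × ℝ} (hPQ : P ≠ Q) (hPl : P ∈ lineSet l) (hQl : Q ∈ lineSet l)
    (hPm : P ∈ lineSet m) (hQm : Q ∈ lineSet m) : lineSet l ⊆ lineSet m := by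
  intro R hRl
  obtain ⟨a, b, c, hab, hlev⟩ := hl.exists_ev_eq
  obtain ⟨a', b', c', -, hmev⟩ := hm.exists_ev_eq
  simp only [lineSet, Set.mem_ofPred_eq, hlev, hmev] at *
  have hcross : (Q.1 - P.1) * (R.2 - P.2) = (Q.2 - P.2) * (R.1 - P.1) := by
    rcases hab with ha | hb
    · refine mul_left_cancel₀ ha ?_
      linear_combination (hQl - hPl) * (R.2 - P.2) - (hRl - hPl) * (Q.2 - P.2)
    · refine mul_left_cancel₀ hb ?_
      linear_combination (hRl - hPl) * (Q.1 - P.1) - (hQl - hPl) * (R.1 - P.1)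
  by_cases hu : Q.1 - P.1 = 0
  · have hv : Q.2 - P.2 ≠ 0 := fun hv => hPQ (Prod.ext (by linarith) (by linarith))
    refine (mul_eq_zero.mp ?_).resolve_left hv
    linear_combination (Q.2 - P.2) * hPm + (hQm - hPm) * (R.2 - P.2) - a' * hcross
  · refine (mul_eq_zero.mp ?_).resolve_left hu
    linear_combination (Q.1 - P.1) * hPm + (hQm - hPm) * (R.1 - P.1) + b' * hcross

lemma lineSet_eq_of_mem {l m : MvPolynomial (Fin 2) ℝ} (hl : IsLinePoly l)
    (hm : IsLinePoly m) {P Q : ℝ × ℝ} (hPQ : P ≠ Q) (hPl : P ∈ lineSet l) (hQl : Q ∈ lineSet l)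
    (hPm : P ∈ lineSet m) (hQm : Q ∈ lineSet m) : lineSet l = lineSet m :=
  (lineSet_subset_of_mem hl hm hPQ hPl hQl hPm hQm).antisymm
    (lineSet_subset_of_mem hm hl hPQ hPm hQm hPl hQl)

/-- A line polynomial vanishes wherever a line polynomial divisible by it does. -/
lemma IsLinePoly.lineSet_subset_of_dvd {l m : MvPolynomial (Fin 2) ℝ} (hl : IsLinePoly l)
    (hm : IsLinePoly m) (h : l ∣ m) : lineSet m ⊆ lineSet l := by
  obtain ⟨k, rfl⟩ := h
  have hk : k ≠ 0 := fun hk => hm.ne_zero (by simp [hk])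
  have hd : (l * k).totalDegree = 1 := hm
  rw [totalDegree_mul_of_isDomain hl.ne_zero hk, show l.totalDegree = 1 from hl,
    Nat.add_eq_left, totalDegree_eq_zero_iff_eq_C] at hd
  have hc : k.coeff 0 ≠ 0 := fun hc => hk (by rw [hd, hc, C_0])
  intro A hA
  have hA' : ev l A * ev k A = 0 := by rw [← ev_mul]; exact hA
  rw [hd] at hA'
  exact (mul_eq_zero.mp hA').resolve_right (by simpa [ev] using hc)

/-- The bivariate polynomial of degree at most two with the given coefficients. -/
noncomputable def quadratic (c : Fin 6 → ℝ) : MvPolynomial (Fin 2) ℝ :=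
  C (c 0) + C (c 1) * X 0 + C (c 2) * X 1 + C (c 3) * (X 0 * X 0) + C (c 4) * (X 0 * X 1) +
    C (c 5) * (X 1 * X 1)

lemma totalDegree_quadratic_le (c : Fin 6 → ℝ) : (quadratic c).totalDegree ≤ 2 := by
  have hlin (a : ℝ) (i : Fin 2) : (C a * X i : MvPolynomial (Fin 2) ℝ).totalDegree ≤ 2 :=
    (totalDegree_mul _ _).trans (by simp)
  have hquad (a : ℝ) (i j : Fin 2) :
      (C a * (X i * X j) : MvPolynomial (Fin 2) ℝ).totalDegree ≤ 2 := by
    refine (totalDegree_mul _ _).trans ?_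
    rw [totalDegree_C, zero_add]
    exact (totalDegree_mul _ _).trans (by simp)
  have hadd {p q : MvPolynomial (Fin 2) ℝ} (hp : p.totalDegree ≤ 2) (hq : q.totalDegree ≤ 2) :
      (p + q).totalDegree ≤ 2 := (totalDegree_add _ _).trans (max_le hp hq)
  have hconst : (C (c 0) : MvPolynomial (Fin 2) ℝ).totalDegree ≤ 2 := by simp
  exact hadd (hadd (hadd (hadd (hadd hconst (hlin _ _)) (hlin _ _)) (hquad _ _ _)) (hquad _ _ _))
    (hquad _ _ _)

lemma ev_quadratic (c : Fin 6 → ℝ) (A : ℝ × ℝ) :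
    ev (quadratic c) A = c 0 + c 1 * A.1 + c 2 * A.2 + c 3 * (A.1 * A.1) + c 4 * (A.1 * A.2) +
      c 5 * (A.2 * A.2) := by
  simp [quadratic, ev]

lemma quadratic_eq_zero {c : Fin 6 → ℝ} (h : quadratic c = 0) : c = 0 := by
  have hev (x y : ℝ) := ev_quadratic c (x, y)
  simp only [h, show ∀ A, ev 0 A = 0 from fun A => by simp [ev]] at hev
  have h1 := hev 0 0
  have h2 := hev 1 0
  have h3 := hev (-1) 0
  have h4 := hev 0 1
  have h5 := hev 0 (-1)
  have h6 := hev 1 1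
  funext i
  fin_cases i <;> simp <;> linarith

/-- Six points on which no non-zero polynomial of degree at most two vanishes are unisolvent for
quadratic interpolation. -/
lemma exists_quadratic_interpolating {S : Set (ℝ × ℝ)} (hS : S.ncard = 6)
    (hpoised : ∀ c, (∀ A ∈ S, ev (quadratic c) A = 0) → quadratic c = 0) (g : ℝ × ℝ → ℝ) :
    ∃ c, ∀ A ∈ S, ev (quadratic c) A = g A := by
  have hfin : S.Finite := Set.finite_of_ncard_pos (by omega)
  have := hfin.fintype
  let T : (Fin 6 → ℝ) →ₗ[ℝ] (S → ℝ) :=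
    { toFun := fun c A => ev (quadratic c) A
      map_add' := fun c d => by funext A; simp only [ev_quadratic, Pi.add_apply]; ring
      map_smul' := fun a c => by
        funext A; simp only [ev_quadratic, Pi.smul_apply, smul_eq_mul, RingHom.id_apply]; ring }
  have hinj : Function.Injective T := (injective_iff_map_eq_zero T).mpr fun c hc =>
    quadratic_eq_zero (hpoised c fun A hA => congrFun hc ⟨A, hA⟩)
  have hdim : Module.finrank ℝ (Fin 6 → ℝ) = Module.finrank ℝ (S → ℝ) := by
    rw [Module.finrank_fin_fun, Module.finrank_fintype_fun_eq_card, ← Nat.card_eq_fintype_card,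
      Nat.card_coe_set_eq, hS]
  obtain ⟨c, hc⟩ := (LinearMap.injective_iff_surjective_of_finrank_eq_finrank hdim).mp hinj
    fun A => g A
  exact ⟨c, fun A hA => congrFun hc ⟨A, hA⟩⟩

/-- If a poised set of degree five has exactly six nodes off the zero set of a cubic `k`, then
`k` divides every quintic vanishing on the other nodes. -/
lemma Poised.dvd_of_vanish {X : Set (ℝ × ℝ)} (hX : Poised 5 X) {k q : MvPolynomial (Fin 2) ℝ}
    (hk0 : k ≠ 0) (hk : k.totalDegree ≤ 3) (hcard : {A ∈ X | ev k A ≠ 0}.ncard = 6)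
    (hq : q.totalDegree ≤ 5) (hvan : ∀ A ∈ X, ev k A = 0 → ev q A = 0) : k ∣ q := by
  have hdeg (c : Fin 6 → ℝ) : (k * quadratic c).totalDegree ≤ 5 :=
    (totalDegree_mul _ _).trans (Nat.add_le_add hk (totalDegree_quadratic_le c))
  obtain ⟨c, hc⟩ := exists_quadratic_interpolating hcard (fun c hc => by
    refine (mul_eq_zero.mp (hX.2.2 _ (hdeg c) fun A hA => ?_)).resolve_left hk0
    rw [ev_mul]
    by_cases hkA : ev k A = 0
    · rw [hkA, zero_mul]
    · rw [hc A ⟨hA, hkA⟩, mul_zero]) fun A => ev q A / ev k A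
  refine ⟨quadratic c, sub_eq_zero.mp (hX.2.2 _
    ((totalDegree_sub _ _).trans (max_le hq (hdeg c))) fun A hA => ?_)⟩
  rw [ev_sub, ev_mul]
  by_cases hkA : ev k A = 0
  · rw [hkA, hvan A hA hkA, zero_mul, sub_zero]
  · rw [hc A ⟨hA, hkA⟩, mul_div_cancel₀ _ hkA, sub_self]

/-- If `B` does not belong to `S` and there are at least `#S / 3` lines through `B` that contain
exactly three points of `S`, then these lines cover `S`. -/
lemma exists_mem_of_lines_through {S : Set (ℝ × ℝ)} (hS : S.Finite) {B : ℝ × ℝ} (hB : B ∉ S)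
    {T : Finset (Set (ℝ × ℝ))}
    (hT : ∀ s ∈ T, ∃ l, IsLinePoly l ∧ lineSet l = s ∧ B ∈ lineSet l ∧ (S ∩ lineSet l).ncard = 3)
    (hcard : S.ncard ≤ 3 * T.card) {A : ℝ × ℝ} (hA : A ∈ S) : ∃ s ∈ T, A ∈ s := by
  classical
  have := hS.fintype
  have hdisj : (T : Set (Set (ℝ × ℝ))).PairwiseDisjoint fun s => (S ∩ s).toFinset := by
    intro s hs t ht hst
    simp only [Function.onFun, Set.disjoint_toFinset]
    rw [Set.disjoint_left]
    rintro P ⟨hPS, hPs⟩ ⟨-, hPt⟩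
    obtain ⟨l, hl, rfl, hBl, -⟩ := hT s hs
    obtain ⟨m, hm, rfl, hBm, -⟩ := hT t ht
    exact hst (lineSet_eq_of_mem hl hm (fun h : P = B => hB (h ▸ hPS)) hPs hBl hPt hBm)
  have hsum : (T.biUnion fun s => (S ∩ s).toFinset).card = 3 * T.card := by
    rw [Finset.card_biUnion hdisj, Finset.sum_const_nat (m := 3), mul_comm]
    intro s hs
    obtain ⟨l, -, rfl, -, h3⟩ := hT s hs
    rw [← Set.ncard_eq_toFinset_card', h3]
  have heq : (T.biUnion fun s => (S ∩ s).toFinset) = S.toFinset := by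
    refine Finset.eq_of_subset_of_card_le ?_ ?_
    · intro P hP
      obtain ⟨s, -, hPs⟩ := Finset.mem_biUnion.mp hP
      exact Set.mem_toFinset.mpr (Set.mem_toFinset.mp hPs).1
    · rw [hsum, ← Set.ncard_eq_toFinset_card']
      exact hcard
  have hA' : A ∈ T.biUnion fun s => (S ∩ s).toFinset := heq ▸ Set.mem_toFinset.mpr hA
  obtain ⟨s, hs, hAs⟩ := Finset.mem_biUnion.mp hA'
  exact ⟨s, hs, (Set.mem_toFinset.mp hAs).2⟩

/-- The nodes on the first three lines are counted by their primary node counts. -/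
lemma ncard_inter_first_three {X : Set (ℝ × ℝ)} (hX : X.Finite)
    (L : Fin 5 → MvPolynomial (Fin 2) ℝ) :
    (X ∩ (lineSet (L 0) ∪ lineSet (L 1) ∪ lineSet (L 2))).ncard =
      resCount X L 0 (L 0) + resCount X L 1 (L 1) + resCount X L 2 (L 2) := by
  have hunion : X ∩ (lineSet (L 0) ∪ lineSet (L 1) ∪ lineSet (L 2)) =
      ({B ∈ X | ev (L 0) B = 0 ∧ ∀ i : Fin 5, i < 0 → ev (L i) B ≠ 0} ∪
        {B ∈ X | ev (L 1) B = 0 ∧ ∀ i : Fin 5, i < 1 → ev (L i) B ≠ 0}) ∪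
        {B ∈ X | ev (L 2) B = 0 ∧ ∀ i : Fin 5, i < 2 → ev (L i) B ≠ 0} := by
    ext B
    simp [lineSet, Fin.forall_fin_succ, Fin.lt_def]
    tauto
  have hfin (p : ℝ × ℝ → Prop) : {B ∈ X | p B}.Finite := hX.subset fun B hB => hB.1
  rw [hunion, Set.ncard_union_eq _ ((hfin _).union (hfin _)) (hfin _),
    Set.ncard_union_eq _ (hfin _) (hfin _)]
  · rfl
  · rw [Set.disjoint_left]
    rintro B ⟨-, h0, -⟩ ⟨-, -, h1⟩
    exact h1 0 (by decide) h0
  · rw [Set.disjoint_left]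
    rintro B (⟨-, h0, -⟩ | ⟨-, h0, -⟩) ⟨-, -, h1⟩
    · exact h1 0 (by decide) h0
    · exact h1 1 (by decide) h0

/-- in the `(5,5,5,3,2)` setup, for every node `B ∈ ℬ` the number of lines
through `B` containing exactly three nodes of `𝒜` is at most 4. -/
theorem at_most_four_three_A_lines
    (X : Set (ℝ × ℝ)) (hX : GCSet 5 X) (hnm : NoMaximalLine 5 X)
    (A0 : ℝ × ℝ) (hA0 : A0 ∈ X) (L : Fin 5 → MvPolynomial (Fin 2) ℝ)
    (hL : MLineSeq X A0 L) (hk : ∀ s, resCount X L s (L s) = ![5, 5, 5, 3, 2] s)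
    (SA SB : Set (ℝ × ℝ))
    (hSA : SA = X ∩ (lineSet (L 0) ∪ lineSet (L 1) ∪ lineSet (L 2)))
    (hSB : SB = X \ SA)
    (B : ℝ × ℝ) (hB : B ∈ SB) :
    {s : Set (ℝ × ℝ) | ∃ l : MvPolynomial (Fin 2) ℝ, IsLinePoly l ∧ lineSet l = s ∧
      B ∈ lineSet l ∧ (SA ∩ lineSet l).ncard = 3}.ncard ≤ 4 := by
  obtain ⟨hpoised, -⟩ := hX
  have hline := hL.1
  have hfin : X.Finite := hpoised.1
  have hSAX : SA ⊆ X := hSA ▸ Set.inter_subset_left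
  have hSAcard : SA.ncard = 15 := by
    rw [hSA, ncard_inter_first_three hfin, hk, hk, hk]
    simp
  have hSBcard : SB.ncard = 6 := by
    rw [hSB, Set.ncard_sdiff hSAX (hfin.subset hSAX), hpoised.2.1, hSAcard]
  have hBA : B ∉ SA := (hSB ▸ hB).2
  by_contra! hcon
  obtain ⟨T, hTsub, hTcard⟩ := Set.exists_subset_card_eq hcon
  have hTfin : T.Finite := Set.finite_of_ncard_pos (by omega)
  lift T to Finset (Set (ℝ × ℝ)) using hTfin
  rw [Set.ncard_coe_finset] at hTcard
  choose! f hf using fun s (hs : s ∈ T) => hTsub hs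
  have hmem (A : ℝ × ℝ) (hA : A ∈ X) : ev (L 0 * L 1 * L 2) A = 0 ↔ A ∈ SA := by
    rw [ev_mul, ev_mul, mul_eq_zero, mul_eq_zero, hSA]
    exact (and_iff_right hA).symm
  have hk0 : L 0 * L 1 * L 2 ≠ 0 :=
    mul_ne_zero (mul_ne_zero (hline 0).ne_zero (hline 1).ne_zero) (hline 2).ne_zero
  have hkdeg : (L 0 * L 1 * L 2).totalDegree ≤ 3 := by
    have h (i) : (L i).totalDegree = 1 := hline i
    have h1 := totalDegree_mul (L 0 * L 1) (L 2)
    have h2 := totalDegree_mul (L 0) (L 1)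
    rw [h] at h1
    rw [h, h] at h2
    omega
  have hkcard : {A ∈ X | ev (L 0 * L 1 * L 2) A ≠ 0}.ncard = 6 := by
    rw [← hSBcard, hSB]
    congr 1
    ext A
    exact and_congr_right fun hA => (hmem A hA).not
  have hqdeg : (∏ s ∈ T, f s).totalDegree ≤ 5 := by
    refine (totalDegree_finsetProd _ _).trans ?_
    rw [Finset.sum_const_nat fun s hs => (hf s hs).1, hTcard]
  have hvan (A : ℝ × ℝ) (hA : A ∈ X) (hkA : ev (L 0 * L 1 * L 2) A = 0) :
      ev (∏ s ∈ T, f s) A = 0 := by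
    obtain ⟨s, hs, hAs⟩ := exists_mem_of_lines_through (hfin.subset hSAX) hBA
      (fun s hs => hTsub hs) (by omega) ((hmem A hA).mp hkA)
    rw [ev_prod]
    refine Finset.prod_eq_zero hs ?_
    rw [← (hf s hs).2.1] at hAs
    exact hAs
  have hdvd : L 0 ∣ ∏ s ∈ T, f s :=
    ((dvd_mul_right _ _).mul_right _).trans
      (hpoised.dvd_of_vanish hk0 hkdeg hkcard hqdeg hvan)
  obtain ⟨s, hs, hdvd⟩ := ((hline 0).prime.dvd_finsetProd_iff _).mp hdvd
  have hB0 := (hline 0).lineSet_subset_of_dvd (hf s hs).1 hdvd (hf s hs).2.2.1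
  exact hBA (hSA ▸ ⟨(hSB ▸ hB).1, Or.inl (Or.inl hB0)⟩)
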